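/- arXiv:2212.03418 — 3 statements merged into one kernel-verified Lean document; each statement's English description precedes it below -/
import Mathlib

section
/- Lindemann–Weierstrass theorem: if α₁, …, αₘ are pairwise distinct algebraic complex numbers, then the exponentials e^{α₁}, …, e^{αₘ} are linearly independent over the field of algebraic numbers; that is, if a₁, …, aₘ are algebraic complex numbers with a₁·e^{α₁} + ⋯ + aₘ·e^{αₘ} = 0, then a₁ = ⋯ = aₘ = 0. -/
open Polynomial in
/-- A finite set of nonzero algebraic elements lies in the roots of an integer polynomial with
nonzero constant coefficient. -/
theorem exists_intPoly_eval_zero_ne_zero {K : Type*} [Field K] [Algebra ℚ K]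
    [Algebra.IsAlgebraic ℚ K] (S : Finset K) (hS : ∀ β ∈ S, β ≠ 0) :
    ∃ F : ℤ[X], F.eval 0 ≠ 0 ∧ ∀ β ∈ S, aeval β F = 0 := by
  have h : ∀ β ∈ S, ∃ q : ℤ[X], q.eval 0 ≠ 0 ∧ aeval β q = 0 := by
    intro β hβ
    have halg : IsAlgebraic ℤ β :=
      (IsFractionRing.isAlgebraic_iff ℤ ℚ K).2 (Algebra.IsAlgebraic.isAlgebraic β)
    obtain ⟨q, hq0, hq⟩ := halg.exists_nonzero_coeff_and_aeval_eq_zero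
      (mem_nonZeroDivisors_of_ne_zero (hS β hβ))
    exact ⟨q, by rwa [← coeff_zero_eq_eval_zero], hq⟩
  choose! q hq0 hq using h
  refine ⟨∏ β ∈ S, q β, ?_, fun β hβ ↦ ?_⟩
  · rw [eval_prod]
    exact Finset.prod_ne_zero_iff.2 hq0
  · rw [map_prod]
    exact Finset.prod_eq_zero hβ (hq β hβ)

open Polynomial in
theorem isIntegral_pow_mul_aeval {K : Type*} [CommRing K] {d : ℤ} {β : K}
    (hβ : IsIntegral ℤ (d * β)) (g : ℤ[X]) {N : ℕ} (hN : g.natDegree ≤ N) :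
    IsIntegral ℤ (d ^ N * aeval β g) := by
  rw [aeval_eq_sum_range' (Nat.lt_succ_of_le hN), Finset.mul_sum]
  refine IsIntegral.sum _ fun i hi ↦ ?_
  have hi' : i ≤ N := Nat.lt_succ_iff.1 (Finset.mem_range.1 hi)
  have : (d : K) ^ N * g.coeff i • β ^ i = ((d ^ (N - i) * g.coeff i : ℤ) : K) * (d * β) ^ i := by
    rw [zsmul_eq_mul, ← Nat.sub_add_cancel hi', pow_add, Nat.add_sub_cancel]
    push_cast
    ring
  rw [this]
  exact (isIntegral_algebraMap (R := ℤ) (A := K) (x := d ^ (N - i) * g.coeff i)).mul (hβ.pow i)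

theorem exists_int_eq_of_forall_fixed {K : Type*} [Field K] [NumberField K] [IsGalois ℚ K]
    {x : K} (hx : IsIntegral ℤ x) (hfix : ∀ σ : K ≃ₐ[ℚ] K, σ x = x) : ∃ n : ℤ, x = n := by
  obtain ⟨q, hq⟩ := IntermediateField.mem_bot.1 ((IsGalois.mem_bot_iff_fixed x).2 hfix)
  rw [← hq, isIntegral_algebraMap_iff (algebraMap ℚ K).injective] at hx
  obtain ⟨n, rfl⟩ := IsIntegrallyClosed.isIntegral_iff.1 hx
  exact ⟨n, by rw [← hq]; simp⟩

open Filter Topology in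
theorem eventually_mul_pow_div_factorial_pred_lt_one (A B : ℝ) :
    ∀ᶠ p : ℕ in atTop, B * A ^ p / (p - 1).factorial < 1 := by
  have h := (FloorSemiring.tendsto_pow_div_factorial_atTop A).const_mul (B * A)
  rw [mul_zero] at h
  filter_upwards [(tendsto_sub_atTop_nat 1).eventually (h.eventually_lt_const one_pos),
    eventually_ge_atTop 1] with p hp h1
  obtain ⟨q, rfl⟩ := Nat.exists_eq_add_of_le' h1
  refine lt_of_eq_of_lt ?_ hp
  rw [Nat.add_sub_cancel]
  ring

open Polynomial in
/-- The arithmetic core: a Galois-invariant integer combination of exponentials with nonzero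
constant coefficient does not vanish. -/
theorem sum_intCast_mul_exp_ne_zero {K : Type*} [Field K] [NumberField K] [IsGalois ℚ K]
    (φ : K →+* ℂ) (c : K →₀ ℤ) (hc : ∀ (σ : K ≃ₐ[ℚ] K) β, c (σ β) = c β) (hc0 : c 0 ≠ 0) :
    c.sum (fun β n ↦ (n : ℂ) * Complex.exp (φ β)) ≠ 0 := by
  classical
  intro hsum
  set S := c.support.erase 0 with hS
  replace hsum : (c 0 : ℂ) + ∑ β ∈ S, (c β : ℂ) * Complex.exp (φ β) = 0 := by
    rw [← hsum, Finsupp.sum, ← Finset.add_sum_erase _ _ (Finsupp.mem_support_iff.2 hc0)]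
    simp [hS]
  obtain ⟨F, hF0, hF⟩ := exists_intPoly_eval_zero_ne_zero S (fun β hβ ↦ (Finset.mem_erase.1 hβ).1)
  obtain ⟨C, hC⟩ := LindemannWeierstrass.exp_polynomial_approx F hF0
  obtain ⟨d, hd0, hd⟩ := exists_integral_multiples ℤ ℚ S
  have hroot : ∀ β ∈ S, φ β ∈ F.aroots ℂ := by
    intro β hβ
    have hne : F ≠ 0 := by rintro rfl; simp at hF0
    rw [mem_aroots]
    refine ⟨hne, ?_⟩
    exact (aeval_algHom_apply φ.toIntAlgHom β F).trans (by simp [hF β hβ])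
  set B : ℝ := ∑ β ∈ S, ‖(c β : ℂ)‖
  obtain ⟨P, hP⟩ := Filter.eventually_atTop.1
    (eventually_mul_pow_div_factorial_pred_lt_one (‖(d : ℂ)‖ ^ F.natDegree * C) B)
  obtain ⟨p, hpge, hp⟩ := Nat.exists_infinite_primes
    (P + (F.eval 0).natAbs + (c 0).natAbs + d.natAbs + 1)
  obtain ⟨n, hn, g, hg, happrox⟩ := hC p (by omega) hp
  replace hP := hP p (by omega)
  set N := p * F.natDegree with hN
  set T : K := d ^ N * ∑ β ∈ S, (c β : K) * aeval β g with hT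
  have hTint : IsIntegral ℤ T := by
    rw [hT, Finset.mul_sum]
    refine IsIntegral.sum _ fun β hβ ↦ ?_
    rw [mul_left_comm]
    refine (isIntegral_algebraMap (R := ℤ) (A := K) (x := c β)).mul
      (isIntegral_pow_mul_aeval ?_ g (hg.trans (Nat.sub_le _ _)))
    simpa using hd β hβ
  have hTfix : ∀ σ : K ≃ₐ[ℚ] K, σ T = T := by
    intro σ
    simp only [hT, map_mul, map_pow, map_sum, map_intCast]
    congr 1
    refine Finset.sum_equiv σ.toEquiv (fun β ↦ ?_) (fun β _ ↦ ?_)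
    · simp [hS, hc]
    · have h1 : σ (aeval β g) = aeval (σ β) g :=
        (aeval_algHom_apply ((σ : K →+* K).toIntAlgHom) β g).symm
      simp [h1, hc]
  obtain ⟨t, ht⟩ := exists_int_eq_of_forall_fixed hTint hTfix
  have htC : (t : ℂ) = d ^ N * ∑ β ∈ S, (c β : ℂ) * aeval (φ β) g := by
    have h1 : ∀ β, φ (aeval β g) = aeval (φ β) g := fun β ↦
      (aeval_algHom_apply φ.toIntAlgHom β g).symm
    have := congrArg φ ht
    simpa [hT, h1] using this.symm
  have hkey : ((d ^ N * n * c 0 + p * t : ℤ) : ℂ) =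
      -(d ^ N * ∑ β ∈ S, (c β : ℂ) * (n • Complex.exp (φ β) - p • aeval (φ β) g)) := by
    have h2 : ∑ β ∈ S, (c β : ℂ) * (n • Complex.exp (φ β) - p • aeval (φ β) g) =
        n * ∑ β ∈ S, (c β : ℂ) * Complex.exp (φ β) - p * ∑ β ∈ S, (c β : ℂ) * aeval (φ β) g := by
      rw [Finset.mul_sum, Finset.mul_sum, ← Finset.sum_sub_distrib]
      refine Finset.sum_congr rfl fun β _ ↦ ?_
      rw [zsmul_eq_mul, nsmul_eq_mul]
      ring
    rw [h2, eq_neg_of_add_eq_zero_right hsum]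
    push_cast
    rw [htC]
    ring
  have hne : d ^ N * n * c 0 + p * t ≠ 0 := by
    intro h
    have hpp := Nat.prime_iff_prime_int.1 hp
    have hdvd : (p : ℤ) ∣ d ^ N * n * c 0 := ⟨-t, by linear_combination h⟩
    have hsmall : ∀ z : ℤ, z ≠ 0 → z.natAbs < p → ¬ (p : ℤ) ∣ z := fun z hz hlt hdvd ↦
      absurd (Nat.le_of_dvd (Int.natAbs_pos.2 hz) (Int.natCast_dvd.1 hdvd)) (not_le.2 hlt)
    rcases hpp.dvd_or_dvd hdvd with h1 | h1
    · rcases hpp.dvd_or_dvd h1 with h1 | h1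
      · exact hsmall d hd0 (by omega) (hpp.dvd_of_dvd_pow h1)
      · exact hn h1
    · exact hsmall _ hc0 (by omega) h1
  have hge : (1 : ℝ) ≤ ‖((d ^ N * n * c 0 + p * t : ℤ) : ℂ)‖ := by
    rw [Complex.norm_intCast]
    exact_mod_cast Int.one_le_abs hne
  refine absurd hP (not_lt.2 (hge.trans ?_))
  calc ‖((d ^ N * n * c 0 + p * t : ℤ) : ℂ)‖
      ≤ ‖(d : ℂ)‖ ^ N * ∑ β ∈ S, ‖(c β : ℂ)‖ * (C ^ p / (p - 1).factorial) := by
        rw [hkey, norm_neg, norm_mul, norm_pow]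
        gcongr
        refine norm_sum_le_of_le _ fun β hβ ↦ ?_
        rw [norm_mul]
        gcongr
        exact happrox (hroot β hβ)
    _ = B * (‖(d : ℂ)‖ ^ F.natDegree * C) ^ p / (p - 1).factorial := by
        rw [← Finset.sum_mul, hN, mul_comm p, pow_mul, mul_pow]
        ring

/-- The ring homomorphism sending a formal combination `∑ aᵢ [αᵢ]` to `∑ φ(aᵢ) e^{φ(αᵢ)}`. -/
noncomputable def expEval {K : Type*} [Field K] (φ : K →+* ℂ) : AddMonoidAlgebra K K →+* ℂ :=
  AddMonoidAlgebra.liftNCRingHom φ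
    (Complex.expMonoidHom.comp (AddMonoidHom.toMultiplicative (φ : K →+ ℂ)))
    (fun _ _ ↦ Commute.all _ _)

theorem expEval_single {K : Type*} [Field K] (φ : K →+* ℂ) (x r : K) :
    expEval φ (AddMonoidAlgebra.single x r) = φ r * Complex.exp (φ x) :=
  AddMonoidAlgebra.liftNCRingHom_single _ _ _ _ _

theorem expEval_apply {K : Type*} [Field K] (φ : K →+* ℂ) (f : AddMonoidAlgebra K K) :
    expEval φ f = f.coeff.sum (fun β a ↦ φ a * Complex.exp (φ β)) := by
  conv_lhs => rw [← AddMonoidAlgebra.sum_coeff_single f]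
  simp [Finsupp.sum, map_sum, expEval_single]

/-- The action of a pair of field automorphisms on `K[K]`, the first on coefficients and the
second on exponents. -/
noncomputable def galoisAct {K : Type*} [Field K] [Algebra ℚ K] (s : (K ≃ₐ[ℚ] K) × (K ≃ₐ[ℚ] K)) :
    AddMonoidAlgebra K K →+* AddMonoidAlgebra K K :=
  (AddMonoidAlgebra.mapRingHom K (s.1 : K →+* K)).comp
    (AddMonoidAlgebra.mapDomainRingHom K ((s.2 : K →+* K) : K →+ K))

theorem galoisAct_single {K : Type*} [Field K] [Algebra ℚ K]
    (s : (K ≃ₐ[ℚ] K) × (K ≃ₐ[ℚ] K)) (x r : K) :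
    galoisAct s (AddMonoidAlgebra.single x r) = AddMonoidAlgebra.single (s.2 x) (s.1 r) := by
  simp [galoisAct]

theorem galoisAct_mul {K : Type*} [Field K] [Algebra ℚ K]
    (s t : (K ≃ₐ[ℚ] K) × (K ≃ₐ[ℚ] K)) (f : AddMonoidAlgebra K K) :
    galoisAct (s * t) f = galoisAct s (galoisAct t f) := by
  induction f using AddMonoidAlgebra.induction_linear with
  | zero => simp
  | add f g hf hg => simp [hf, hg]
  | single x r => simp [galoisAct_single]

theorem galoisAct_one {K : Type*} [Field K] [Algebra ℚ K] (f : AddMonoidAlgebra K K) :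
    galoisAct 1 f = f := by
  induction f using AddMonoidAlgebra.induction_linear with
  | zero => simp
  | add f g hf hg => simp [hf, hg]
  | single x r => simp [galoisAct_single]

theorem galoisAct_injective {K : Type*} [Field K] [Algebra ℚ K]
    (s : (K ≃ₐ[ℚ] K) × (K ≃ₐ[ℚ] K)) : Function.Injective (galoisAct s) :=
  Function.LeftInverse.injective (g := galoisAct s⁻¹) fun f ↦ by
    rw [← galoisAct_mul, inv_mul_cancel, galoisAct_one]

theorem coeff_galoisAct {K : Type*} [Field K] [Algebra ℚ K]
    (s : (K ≃ₐ[ℚ] K) × (K ≃ₐ[ℚ] K)) (f : AddMonoidAlgebra K K) (x : K) :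
    (galoisAct s f).coeff (s.2 x) = s.1 (f.coeff x) := by
  classical
  induction f using AddMonoidAlgebra.induction_linear with
  | zero => simp
  | add f g hf hg => simp [hf, hg]
  | single y r =>
    simp [galoisAct_single, Finsupp.single_apply, apply_ite s.1]

/-- The product of all conjugates of `f` is invariant under `galoisAct`. -/
theorem galoisAct_prod_galoisAct {K : Type*} [Field K] [NumberField K]
    (s : (K ≃ₐ[ℚ] K) × (K ≃ₐ[ℚ] K)) (f : AddMonoidAlgebra K K) :
    galoisAct s (∏ t, galoisAct t f) = ∏ t, galoisAct t f := by
  simp_rw [map_prod, ← galoisAct_mul]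
  exact Fintype.prod_equiv (Equiv.mulLeft s) _ _ fun _ ↦ rfl

/-- A nontrivial linear relation between exponentials yields one which is invariant under
`galoisAct` and has nonzero constant coefficient. -/
theorem exists_galoisAct_invariant {K : Type*} [Field K] [NumberField K] (φ : K →+* ℂ)
    {f : AddMonoidAlgebra K K} (hf0 : f ≠ 0) (hf : expEval φ f = 0) :
    ∃ h : AddMonoidAlgebra K K, (∀ s, galoisAct s h = h) ∧ h.coeff 0 ≠ 0 ∧ expEval φ h = 0 := by
  classical
  set g := ∏ t, galoisAct t f with hg
  have hginv : ∀ s, galoisAct s g = g := fun s ↦ galoisAct_prod_galoisAct s f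
  have hg0 : g ≠ 0 := Finset.prod_ne_zero_iff.2 fun t _ ↦
    (map_ne_zero_iff _ (galoisAct_injective t)).2 hf0
  have hgexp : expEval φ g = 0 := by
    rw [hg, map_prod]
    exact Finset.prod_eq_zero (Finset.mem_univ 1) (by rw [galoisAct_one, hf])
  obtain ⟨β, hβ⟩ : ∃ β, g.coeff β ≠ 0 := by
    by_contra! h
    exact hg0 (by ext x; simpa using h x)
  refine ⟨g * ∑ τ : K ≃ₐ[ℚ] K, AddMonoidAlgebra.single (-τ β) 1, fun s ↦ ?_, ?_, ?_⟩
  · rw [map_mul, hginv, map_sum]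
    congr 1
    refine Fintype.sum_equiv (Equiv.mulLeft s.2) _ _ fun τ ↦ ?_
    simp [galoisAct_single]
  · have hτ : ∀ τ : K ≃ₐ[ℚ] K, (g * AddMonoidAlgebra.single (-τ β) 1).coeff 0 = g.coeff β := by
      intro τ
      rw [AddMonoidAlgebra.coeff_mul_single_eq_coeff_mul (τ β)
        (fun m _ ↦ by rw [add_neg_eq_zero]), mul_one]
      simpa [hginv] using coeff_galoisAct (1, τ) g β
    rw [Finset.mul_sum, AddMonoidAlgebra.coeff_sum, Finsupp.finsetSum_apply]
    simp [hτ, hβ]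
  · rw [map_mul, hgexp, zero_mul]

theorem exists_nat_mul_eq_intCast {ι : Type*} (s : Finset ι) (q : ι → ℚ) :
    ∃ D : ℕ, D ≠ 0 ∧ ∀ i ∈ s, ∃ n : ℤ, (D : ℚ) * q i = n := by
  refine ⟨∏ i ∈ s, (q i).den, Finset.prod_ne_zero_iff.2 fun i _ ↦ (q i).den_ne_zero,
    fun i hi ↦ ?_⟩
  obtain ⟨k, hk⟩ := Finset.dvd_prod_of_mem (fun i ↦ (q i).den) hi
  refine ⟨k * (q i).num, ?_⟩
  rw [hk]
  push_cast
  rw [mul_comm ((q i).den : ℚ), mul_assoc, Rat.den_mul_eq_num]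

/-- The exponentials of distinct elements of a Galois number field are linearly independent over
it. -/
theorem expEval_injective {K : Type*} [Field K] [NumberField K] [IsGalois ℚ K] (φ : K →+* ℂ) :
    Function.Injective (expEval φ) := by
  rw [injective_iff_map_eq_zero]
  intro f hf
  by_contra hf0
  obtain ⟨h, hinv, h0, hexp⟩ := exists_galoisAct_invariant φ hf0 hf
  have hrat : ∀ x, ∃ q : ℚ, (q : K) = h.coeff x := by
    intro x
    obtain ⟨q, hq⟩ := IntermediateField.mem_bot.1 <| (IsGalois.mem_bot_iff_fixed (h.coeff x)).2
      fun σ ↦ by simpa [hinv] using (coeff_galoisAct (σ, 1) h x).symm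
    exact ⟨q, by simpa using hq⟩
  choose q hq using hrat
  obtain ⟨D, hD0, hD⟩ := exists_nat_mul_eq_intCast h.coeff.support q
  choose! c hc using hD
  have hcoeff : ∀ x ∈ h.coeff.support, (c x : K) = D * h.coeff x := by
    intro x hx
    rw [← hq]
    exact_mod_cast (congrArg (fun r : ℚ ↦ (r : K)) (hc x hx)).symm
  classical
  let C : K →₀ ℤ := Finsupp.onFinset h.coeff.support
    (fun x ↦ if x ∈ h.coeff.support then c x else 0) (fun x hx ↦ by
      by_contra hx'
      exact hx (if_neg hx'))
  have hC : ∀ x, (C x : K) = D * h.coeff x := by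
    intro x
    by_cases hx : x ∈ h.coeff.support
    · simpa only [C, Finsupp.onFinset_apply, if_pos hx] using hcoeff x hx
    · simp only [C, Finsupp.onFinset_apply, if_neg hx, Finsupp.notMem_support_iff.1 hx]
      simp
  refine sum_intCast_mul_exp_ne_zero φ C (fun σ β ↦ ?_) ?_ ?_
  · have h1 : h.coeff (σ β) = h.coeff β := by
      simpa [hinv] using coeff_galoisAct (1, σ) h β
    exact_mod_cast (by rw [hC, hC, h1] : (C (σ β) : K) = C β)
  · intro hz
    have := hC 0
    rw [hz, Int.cast_zero, eq_comm, mul_eq_zero] at this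
    exact this.elim (by exact_mod_cast hD0) h0
  · have hsub : C.support ⊆ h.coeff.support := Finsupp.support_onFinset_subset
    rw [Finsupp.sum_of_support_subset _ hsub _ (by simp), ← mul_zero (D : ℂ), ← hexp,
      expEval_apply, Finsupp.sum, Finset.mul_sum]
    refine Finset.sum_congr rfl fun β _ ↦ ?_
    have := congrArg φ (hC β)
    rw [map_mul, map_natCast, map_intCast] at this
    rw [this, mul_assoc]

/-- Lindemann–Weierstrass theorem: if `α 1, …, α m` are pairwise distinct algebraic
complex numbers, then `e^{α 1}, …, e^{α m}` are linearly independent over the field of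
algebraic numbers. -/
theorem lindemann_weierstrass (m : ℕ) (α : Fin m → ℂ)
    (hdist : Function.Injective α) (halg : ∀ i, IsAlgebraic ℚ (α i))
    (a : Fin m → ℂ) (ha : ∀ i, IsAlgebraic ℚ (a i))
    (hsum : ∑ i, a i * Complex.exp (α i) = 0) :
    ∀ i, a i = 0 := by
  set S : Set ℂ := Set.range α ∪ Set.range a with hS
  set L := IntermediateField.adjoin ℚ S
  have : FiniteDimensional ℚ L :=
    have : Finite S := ((Set.finite_range α).union (Set.finite_range a)).to_subtype
    IntermediateField.finiteDimensional_adjoin <| by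
      rintro x (⟨i, rfl⟩ | ⟨i, rfl⟩)
      exacts [(halg i).isIntegral, (ha i).isIntegral]
  set K := IntermediateField.normalClosure ℚ L ℂ
  have hSK : ∀ x ∈ S, x ∈ K := fun x hx ↦
    IntermediateField.le_normalClosure L (IntermediateField.subset_adjoin ℚ S hx)
  have : NumberField K := ⟨⟩
  have : IsNormalClosure ℚ L K :=
    Algebra.IsAlgebraic.isNormalClosure_normalClosure fun _ ↦ IsAlgClosed.splits _
  have : Normal ℚ K := IsNormalClosure.normal (K := L)
  have : IsGalois ℚ K := ⟨⟩
  let α' : Fin m → K := fun i ↦ ⟨α i, hSK _ (Or.inl ⟨i, rfl⟩)⟩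
  let a' : Fin m → K := fun i ↦ ⟨a i, hSK _ (Or.inr ⟨i, rfl⟩)⟩
  have hα' : Function.Injective α' := fun i j hij ↦ hdist (congrArg Subtype.val hij)
  have hzero : ∑ i, AddMonoidAlgebra.single (α' i) (a' i) = 0 := by
    refine expEval_injective (algebraMap K ℂ) ?_
    rw [map_sum, map_zero, ← hsum]
    exact Finset.sum_congr rfl fun i _ ↦ expEval_single _ _ _
  intro i
  have hi : a' i = 0 := by
    classical
    have := congrArg (fun f : AddMonoidAlgebra K K ↦ f.coeff (α' i)) hzero
    simpa [AddMonoidAlgebra.coeff_sum, Finsupp.finsetSum_apply, Finsupp.single_apply,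
      hα'.eq_iff] using this
  exact congrArg Subtype.val hi
end

section
/- Let g be a nonconstant polynomial with rational coefficients and h a polynomial with rational coefficients. If α is a nonzero complex number with sin(α) ≠ 0 satisfying g(sin α) = h(α), then α is transcendental. -/
open Polynomial in
/-- Clearing denominators: if `L • x` is integral, then so is `L ^ N` times any integer polynomial
of degree at most `N` evaluated at `x`. -/
theorem IsIntegral.pow_mul_aeval {K : Type*} [CommRing K] {L : ℤ} {x : K}
    (hx : IsIntegral ℤ (L • x)) {q : ℤ[X]} {N : ℕ} (hq : q.natDegree ≤ N) :
    IsIntegral ℤ ((L : K) ^ N * aeval x q) := by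
  rw [aeval_eq_sum_range' (Nat.lt_succ_of_le hq), Finset.mul_sum]
  refine IsIntegral.sum _ fun i hi ↦ ?_
  have hi : i ≤ N := Nat.lt_succ_iff.mp (Finset.mem_range.mp hi)
  have key : (L : K) ^ N * (q.coeff i • x ^ i) =
      ((q.coeff i * L ^ (N - i) : ℤ) : K) * (L • x) ^ i := by
    rw [← Nat.sub_add_cancel hi, pow_add, Nat.add_sub_cancel, zsmul_eq_mul, zsmul_eq_mul]
    push_cast
    ring
  rw [key, ← zsmul_eq_mul]
  exact (hx.pow i).smul _

/-- An algebraic integer fixed by the Galois group is a rational integer. -/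
theorem IsIntegral.exists_int_eq_of_fixed {K : Type*} [Field K] [Algebra ℚ K]
    [FiniteDimensional ℚ K] [IsGalois ℚ K] {y : K} (hy : IsIntegral ℤ y)
    (hfix : ∀ σ : K ≃ₐ[ℚ] K, σ y = y) : ∃ z : ℤ, (z : K) = y := by
  obtain ⟨r, hr⟩ := IntermediateField.mem_bot.mp ((IsGalois.mem_bot_iff_fixed y).mpr hfix)
  have hr' : IsIntegral ℤ r := by
    rw [← hr] at hy
    exact (isIntegral_algebraMap_iff (algebraMap ℚ K).injective).mp hy
  obtain ⟨z, hz⟩ := IsIntegrallyClosed.isIntegral_iff.mp hr'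
  exact ⟨z, by rw [← hr, ← hz]; simp⟩

open Polynomial in
/-- A finite set of nonzero algebraic numbers is annihilated by an integer polynomial with nonzero
constant term. -/
theorem exists_int_polynomial_aeval_eq_zero {K : Type*} [Field K] [Algebra ℚ K]
    [Algebra.IsAlgebraic ℚ K] (S : Finset K) (hS : 0 ∉ S) :
    ∃ f : ℤ[X], f.eval 0 ≠ 0 ∧ ∀ x ∈ S, aeval x f = 0 := by
  have h (x : K) (hx : x ≠ 0) : ∃ f : ℤ[X], f.eval 0 ≠ 0 ∧ aeval x f = 0 := by
    have hx' : IsAlgebraic ℤ x :=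
      (IsFractionRing.isAlgebraic_iff ℤ ℚ K).mpr (Algebra.IsAlgebraic.isAlgebraic x)
    obtain ⟨q, hq, hqx⟩ :=
      hx'.exists_nonzero_coeff_and_aeval_eq_zero (mem_nonZeroDivisors_of_ne_zero hx)
    exact ⟨q, by rwa [← coeff_zero_eq_eval_zero], hqx⟩
  choose! f hf0 hf using h
  have hne {x : K} (hx : x ∈ S) : x ≠ 0 := fun h0 ↦ hS (h0 ▸ hx)
  refine ⟨∏ x ∈ S, f x, ?_, fun x hx ↦ ?_⟩
  · rw [eval_prod]
    exact Finset.prod_ne_zero_iff.mpr fun x hx ↦ hf0 x (hne hx)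
  · rw [map_prod]
    exact Finset.prod_eq_zero hx (hf x (hne hx))

open Polynomial Filter in
/-- A linear combination of exponentials whose integer coefficients are invariant under the Galois
group does not vanish if the coefficient of `exp 0` is nonzero. -/
theorem sum_mul_exp_ne_zero_of_invariant {K : Type*} [Field K] [Algebra ℚ K]
    [FiniteDimensional ℚ K] [IsGalois ℚ K] (φ : K →+* ℂ) (m : K →₀ ℤ) (hm0 : m 0 ≠ 0)
    (hm : ∀ (σ : K ≃ₐ[ℚ] K) (x : K), m (σ x) = m x) :
    m.sum (fun x c ↦ (c : ℂ) * Complex.exp (φ x)) ≠ 0 := by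
  classical
  intro hsum
  have : Algebra.IsAlgebraic ℤ K :=
    (IsFractionRing.comap_isAlgebraic_iff (A := ℤ) (K := ℚ) (C := K)).mpr inferInstance
  have map_aeval (x : K) (q : ℤ[X]) : φ (aeval x q) = aeval (φ x) q :=
    (aeval_algHom_apply φ.toIntAlgHom x q).symm
  set S := m.support.erase 0 with hS
  obtain ⟨L, hL0, hL⟩ := Algebra.IsAlgebraic.exists_integral_multiples ℤ S
  obtain ⟨f, hf0, hf⟩ := exists_int_polynomial_aeval_eq_zero S (Finset.notMem_erase _ _)
  have hroot {x : K} (hx : x ∈ S) : φ x ∈ f.aroots ℂ := by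
    rw [mem_aroots]
    refine ⟨fun h ↦ hf0 (by simp [h]), ?_⟩
    rw [← map_aeval, hf x hx, map_zero]
  obtain ⟨c, hc⟩ := LindemannWeierstrass.exp_polynomial_approx f hf0
  set d := f.natDegree
  set B : ℝ := ∑ x ∈ S, |(m x : ℝ)|
  set b : ℝ := |(L : ℝ)| ^ d * c with hb
  have hlim : ∀ᶠ n : ℕ in atTop, B * b * (b ^ n / n.factorial) < 1 := by
    have := (FloorSemiring.tendsto_pow_div_factorial_atTop b).const_mul (B * b)
    rw [mul_zero] at this
    exact this.eventually_lt_const one_pos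
  obtain ⟨N₀, hN₀⟩ := eventually_atTop.mp hlim
  obtain ⟨p, hpN, hp⟩ :=
    Nat.exists_infinite_primes (N₀ + 1 + (f.eval 0).natAbs + L.natAbs + (m 0).natAbs + 1)
  obtain ⟨n, hpn, q, hqdeg, hq⟩ := hc p (by lia) hp
  have hsplit : (m 0 : ℂ) + ∑ x ∈ S, (m x : ℂ) * Complex.exp (φ x) = 0 := by
    rw [← hsum, Finsupp.sum, hS, ← Finset.add_sum_erase _ _ (Finsupp.mem_support_iff.mpr hm0)]
    simp
  set y : K := (L : K) ^ (p * d) * ∑ x ∈ S, (m x : K) * aeval x q with hy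
  have hyint : IsIntegral ℤ y := by
    rw [hy, Finset.mul_sum]
    refine IsIntegral.sum _ fun x hx ↦ ?_
    rw [mul_left_comm, ← zsmul_eq_mul]
    exact ((hL x hx).pow_mul_aeval (hqdeg.trans (Nat.sub_le _ _))).smul _
  have hyfix (σ : K ≃ₐ[ℚ] K) : σ y = y := by
    rw [hy, map_mul, map_pow, map_intCast, map_sum]
    congr 1
    refine Finset.sum_bij (fun x _ ↦ σ x) (fun x hx ↦ ?_) (fun _ _ _ _ h ↦ σ.injective h)
      (fun x hx ↦ ⟨σ.symm x, ?_, by simp⟩) (fun x hx ↦ ?_)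
    · simpa [hS, hm] using hx
    · have := hm σ (σ.symm x)
      rw [AlgEquiv.apply_symm_apply] at this
      simpa [hS, ← this] using hx
    · rw [map_mul, map_intCast, hm]
      exact congrArg _ (aeval_algHom_apply (σ : K →+* K).toIntAlgHom x q).symm
  obtain ⟨z, hz⟩ := hyint.exists_int_eq_of_fixed hyfix
  have hzC : (z : ℂ) = (L : ℂ) ^ (p * d) * ∑ x ∈ S, (m x : ℂ) * aeval (φ x) q := by
    have := congrArg φ hz
    rw [map_intCast, hy, map_mul, map_pow, map_intCast, map_sum] at this
    rw [this]
    congr 1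
    refine Finset.sum_congr rfl fun x _ ↦ ?_
    rw [map_mul, map_intCast, map_aeval]
  set w : ℤ := L ^ (p * d) * m 0 * n + p * z with hw
  have hwC : (w : ℂ) = -((L : ℂ) ^ (p * d) *
      ∑ x ∈ S, (m x : ℂ) * (n • Complex.exp (φ x) - p • aeval (φ x) q)) := by
    have h1 : ∑ x ∈ S, (m x : ℂ) * (n • Complex.exp (φ x) - p • aeval (φ x) q) =
        n * ∑ x ∈ S, (m x : ℂ) * Complex.exp (φ x) -
          p * ∑ x ∈ S, (m x : ℂ) * aeval (φ x) q := by
      rw [Finset.mul_sum, Finset.mul_sum, ← Finset.sum_sub_distrib]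
      refine Finset.sum_congr rfl fun x _ ↦ ?_
      rw [zsmul_eq_mul, nsmul_eq_mul]
      ring
    rw [h1, hw]
    push_cast
    rw [hzC]
    linear_combination (L : ℂ) ^ (p * d) * n * hsplit
  have hwlt : |(w : ℝ)| < 1 := by
    have h2 : ‖∑ x ∈ S, (m x : ℂ) * (n • Complex.exp (φ x) - p • aeval (φ x) q)‖ ≤
        B * (c ^ p / (p - 1).factorial) := by
      rw [Finset.sum_mul]
      refine norm_sum_le_of_le _ fun x hx ↦ ?_
      rw [norm_mul, Complex.norm_intCast]
      exact mul_le_mul_of_nonneg_left (hq (hroot hx)) (abs_nonneg _)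
    rw [← Complex.norm_intCast, hwC, norm_neg, norm_mul, norm_pow, Complex.norm_intCast]
    refine (mul_le_mul_of_nonneg_left h2 (by positivity)).trans_lt ?_
    refine lt_of_eq_of_lt ?_ (hN₀ (p - 1) (by lia))
    have : b ^ p = b * b ^ (p - 1) := by rw [← pow_succ', Nat.sub_add_cancel hp.one_le]
    rw [show B * b * (b ^ (p - 1) / (p - 1).factorial) = B * (b ^ p / (p - 1).factorial) by
      rw [this]; ring, hb, mul_pow, ← pow_mul, mul_comm d p]
    ring
  have hw0 : w = 0 := Int.abs_lt_one_iff.mp (by exact_mod_cast hwlt)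
  have hdvd : (p : ℤ) ∣ L ^ (p * d) * m 0 * n :=
    (dvd_add_left (dvd_mul_right _ z)).mp (by rw [← hw, hw0]; exact dvd_zero _)
  have hpZ : Prime (p : ℤ) := Nat.prime_iff_prime_int.mp hp
  have hsmall {a : ℤ} (ha : a ≠ 0) (hap : a.natAbs < p) : ¬ (p : ℤ) ∣ a := fun h ↦
    absurd (Nat.le_of_dvd (Int.natAbs_pos.mpr ha) (Int.natCast_dvd.mp h)) (not_le.mpr hap)
  rcases hpZ.dvd_or_dvd hdvd with h | h
  · rcases hpZ.dvd_or_dvd h with h | h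
    · exact hsmall hL0 (by lia) (hpZ.dvd_of_dvd_pow h)
    · exact hsmall hm0 (by lia) h
  · exact hpn h

open AddMonoidAlgebra in
/-- In a group ring on which a finite group of automorphisms of the exponents acts, a nonzero
element of the kernel of a ring homomorphism can be replaced by an invariant one with nonzero
coefficient at `0`. -/
theorem exists_invariant_mem_ker {K : Type*} [Field K] [Algebra ℚ K]
    [FiniteDimensional ℚ K] (E : AddMonoidAlgebra ℤ K →+* ℂ) {F : AddMonoidAlgebra ℤ K}
    (hF : F ≠ 0) (hE : E F = 0) :
    ∃ M : AddMonoidAlgebra ℤ K, E M = 0 ∧ M.coeff 0 ≠ 0 ∧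
      ∀ (σ : K ≃ₐ[ℚ] K) (x : K), M.coeff (σ x) = M.coeff x := by
  classical
  let act (σ : K ≃ₐ[ℚ] K) : AddMonoidAlgebra ℤ K ≃ₐ[ℤ] AddMonoidAlgebra ℤ K :=
    domCongr ℤ ℤ (σ : K ≃+ K)
  have act_coeff (σ : K ≃ₐ[ℚ] K) (G : AddMonoidAlgebra ℤ K) (x : K) :
      (act σ G).coeff x = G.coeff (σ.symm x) := coeff_domCongr ..
  have act_mul (σ τ : K ≃ₐ[ℚ] K) (G : AddMonoidAlgebra ℤ K) :
      act σ (act τ G) = act (σ * τ) G := by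
    ext x
    rw [act_coeff, act_coeff, act_coeff]
    rfl
  have act_one : act 1 F = F := by
    ext x
    rw [act_coeff]
    rfl
  set N : AddMonoidAlgebra ℤ K := ∏ σ : K ≃ₐ[ℚ] K, act σ F with hN
  have hN0 : N ≠ 0 := Finset.prod_ne_zero_iff.mpr fun σ _ ↦ by simpa using hF
  have hNact (τ : K ≃ₐ[ℚ] K) : act τ N = N := by
    rw [hN, map_prod]
    simp_rw [act_mul]
    exact Fintype.prod_equiv (Equiv.mulLeft τ) _ _ fun _ ↦ rfl
  have hNE : E N = 0 := by
    rw [hN, map_prod]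
    exact Finset.prod_eq_zero (Finset.mem_univ 1) (by rw [act_one, hE])
  obtain ⟨γ, hγ⟩ : ∃ γ, N.coeff γ ≠ 0 := by
    by_contra! h
    exact hN0 (AddMonoidAlgebra.ext (Finsupp.ext h))
  set T : AddMonoidAlgebra ℤ K := ∑ τ : K ≃ₐ[ℚ] K, single (-τ γ) 1 with hT
  have hTact (σ : K ≃ₐ[ℚ] K) : act σ T = T := by
    rw [hT, map_sum]
    refine Fintype.sum_equiv (Equiv.mulLeft σ) _ _ fun τ ↦ ?_
    simp only [act, domCongr_single, map_neg]
    rfl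
  have hNinv (σ : K ≃ₐ[ℚ] K) (x : K) : N.coeff (σ x) = N.coeff x := by
    have := act_coeff σ N (σ x)
    rwa [hNact, AlgEquiv.symm_apply_apply] at this
  refine ⟨N * T, by rw [map_mul, hNE, zero_mul], ?_, fun σ x ↦ ?_⟩
  · have h (τ : K ≃ₐ[ℚ] K) : (N * single (-τ γ) 1).coeff 0 = N.coeff γ := by
      rw [coeff_mul_single_eq_coeff_mul (τ γ) fun a _ ↦ by rw [add_neg_eq_zero], mul_one, hNinv]
    rw [hT, Finset.mul_sum, coeff_sum, Finsupp.finsetSum_apply, Finset.sum_congr rfl fun τ _ ↦ h τ]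
    simpa using hγ
  · have := act_coeff σ (N * T) (σ x)
    rwa [map_mul, hNact, hTact, AlgEquiv.symm_apply_apply] at this

open Polynomial AddMonoidAlgebra in
/-- **Hermite–Lindemann theorem**: the exponential of a nonzero algebraic number is
transcendental. -/
theorem transcendental_exp_of_isAlgebraic {β : ℂ} (hβ : IsAlgebraic ℚ β) (hβ0 : β ≠ 0) :
    Transcendental ℚ (Complex.exp β) := by
  intro halg
  obtain ⟨P, hP0, hP⟩ := (IsFractionRing.isAlgebraic_iff ℤ ℚ ℂ).mpr halg
  let K := IntermediateField.adjoin ℚ ((minpoly ℚ β).rootSet ℂ)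
  have : (minpoly ℚ β).IsSplittingField ℚ K :=
    IntermediateField.adjoin_rootSet_isSplittingField (IsAlgClosed.splits _)
  have : FiniteDimensional ℚ K := IsSplittingField.finiteDimensional K (minpoly ℚ β)
  have : IsGalois ℚ K :=
    IsGalois.of_separable_splitting_field (minpoly.irreducible hβ.isIntegral).separable
  have hβK : β ∈ K := IntermediateField.subset_adjoin _ _ <|
    mem_rootSet.mpr ⟨minpoly.ne_zero hβ.isIntegral, minpoly.aeval ℚ β⟩
  let β' : K := ⟨β, hβK⟩
  have hβ'0 : β' ≠ 0 := fun h ↦ hβ0 (congrArg Subtype.val h)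
  let φ : K →+* ℂ := algebraMap K ℂ
  let E : AddMonoidAlgebra ℤ K →ₐ[ℤ] ℂ := AddMonoidAlgebra.lift ℤ ℂ K
    (Complex.expMonoidHom.comp φ.toAddMonoidHom.toMultiplicative)
  have hE (G : AddMonoidAlgebra ℤ K) :
      E G = G.coeff.sum fun x c ↦ (c : ℂ) * Complex.exp (φ x) :=
    AddMonoidAlgebra.lift_apply' _ _
  have hEβ : E (single β' 1) = Complex.exp β := by
    simp [hE]
    rfl
  set F : AddMonoidAlgebra ℤ K := aeval (single β' 1) P
  have hEF : E F = 0 := by rw [← aeval_algHom_apply, hEβ, hP]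
  have hF : F ≠ 0 := by
    intro hF
    have : F.coeff (P.natDegree • β') = P.leadingCoeff := by
      rw [show F = _ from aeval_eq_sum_range _, AddMonoidAlgebra.coeff_sum, Finsupp.finsetSum_apply,
        Finset.sum_eq_single P.natDegree]
      · simp
      · intro i _ hi
        rw [AddMonoidAlgebra.single_pow]
        simp [hi, hβ'0]
      · simp
    rw [hF] at this
    exact hP0 (leadingCoeff_eq_zero.mp this.symm)
  obtain ⟨M, hEM, hM0, hM⟩ := exists_invariant_mem_ker (E : AddMonoidAlgebra ℤ K →+* ℂ) hF hEF
  exact sum_mul_exp_ne_zero_of_invariant φ M.coeff hM0 hM ((hE M).symm.trans hEM)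

/-- The sine of a nonzero algebraic number is transcendental. -/
theorem transcendental_sin_of_isAlgebraic {α : ℂ} (hα : IsAlgebraic ℚ α) (hα0 : α ≠ 0) :
    Transcendental ℚ (Complex.sin α) := by
  intro hs
  have hI : IsAlgebraic ℚ Complex.I :=
    (IsIntegral.of_pow two_pos (by rw [Complex.I_sq]; exact isIntegral_one.neg)).isAlgebraic
  have hc : IsAlgebraic ℚ (Complex.cos α) := by
    refine (IsIntegral.of_pow two_pos ?_).isAlgebraic
    rw [Complex.cos_sq']
    exact isIntegral_one.sub (hs.isIntegral.pow 2)
  refine transcendental_exp_of_isAlgebraic (hα.mul hI) (mul_ne_zero hα0 Complex.I_ne_zero) ?_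
  rw [Complex.exp_mul_I]
  exact hc.add (hs.mul hI)


/-- If `g` is a nonconstant rational polynomial, `h` a rational polynomial, and `α ≠ 0`
with `sin α ≠ 0` satisfies `g (sin α) = h α`, then `α` is transcendental. -/
theorem transcendental_of_poly_sin (g h : Polynomial ℚ)
    (hg : g.natDegree ≠ 0) (α : ℂ) (hα : α ≠ 0) (hsin : Complex.sin α ≠ 0)
    (heq : Polynomial.aeval (Complex.sin α) g = Polynomial.aeval α h) :
    Transcendental ℚ α := by
  intro hα_alg
  have hg0 : g ≠ 0 := fun h ↦ hg (by simp [h])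
  have hconst : IsAlgebraic ℚ (Polynomial.aeval (Complex.sin α) g) := by
    rw [heq]
    exact IsIntegral.isAlgebraic <| adjoin_le_integralClosure (IsAlgebraic.isIntegral hα_alg)
      (Polynomial.aeval_mem_adjoin_singleton ℚ α)
  exact transcendental_sin_of_isAlgebraic hα_alg hα
    (IsAlgebraic.of_aeval g hg (mem_nonZeroDivisors_of_ne_zero (by simpa using hg0)) hconst)
end

section
/- Let j and k be positive integers, let a₁ be an algebraic complex number, and let g be a polynomial with rational coefficients. If α is a nonzero complex number satisfying (e^{α^j} + a₁)^k = g(α) with g(α) ≠ 0, then α is transcendental. -/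
namespace HermiteLindemann

open Polynomial

lemma isIntegral_pow_mul_aeval {K : Type*} [Field K] {l : ℤ} {s : K}
    (hs : IsIntegral ℤ ((l : K) * s)) {q : ℤ[X]} {D : ℕ} (hq : q.natDegree ≤ D) :
    IsIntegral ℤ ((l : K) ^ D * aeval s q) := by
  have hl : IsIntegral ℤ (l : K) := isIntegral_algebraMap (R := ℤ) (x := l)
  rw [aeval_eq_sum_range' (Nat.lt_succ_of_le hq), Finset.mul_sum]
  refine IsIntegral.sum _ fun i hi ↦ ?_
  have hi : i ≤ D := Nat.lt_succ_iff.mp (Finset.mem_range.mp hi)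
  have : (l : K) ^ D * (q.coeff i • s ^ i) = (q.coeff i : K) * (l ^ (D - i) * (l * s) ^ i) := by
    rw [zsmul_eq_mul, mul_pow, ← pow_sub_mul_pow (l : K) hi]
    ring
  rw [this]
  exact (isIntegral_algebraMap (R := ℤ) (x := q.coeff i)).mul ((hl.pow _).mul (hs.pow _))

lemma exists_int_polynomial_aeval_eq_zero {K : Type*} [Field K] [NumberField K]
    (S : Finset K) (h0 : (0 : K) ∉ S) :
    ∃ f : ℤ[X], f.eval 0 ≠ 0 ∧ ∀ s ∈ S, aeval s f = 0 := by
  have key (s : K) (hs : s ∈ S) : ∃ q : ℤ[X], q.coeff 0 ≠ 0 ∧ aeval s q = 0 := by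
    have : IsAlgebraic ℤ s := (IsFractionRing.isAlgebraic_iff ℤ ℚ K).mpr
      (Algebra.IsAlgebraic.isAlgebraic s)
    exact this.exists_nonzero_coeff_and_aeval_eq_zero
      (mem_nonZeroDivisors_of_ne_zero fun h ↦ h0 (h ▸ hs))
  choose! q hq hqs using key
  refine ⟨∏ s ∈ S, q s, ?_, fun s hs ↦ ?_⟩
  · rw [eval_prod, Finset.prod_ne_zero_iff]
    intro s hs
    rw [← coeff_zero_eq_eval_zero]
    exact hq s hs
  · rw [map_prod]
    exact Finset.prod_eq_zero hs (hqs s hs)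

lemma exists_int_eq_of_fixed {K : Type*} [Field K] [NumberField K] [IsGalois ℚ K] {x : K}
    (hx : IsIntegral ℤ x) (hfix : ∀ σ : Gal(K/ℚ), σ x = x) : ∃ m : ℤ, (m : K) = x := by
  obtain ⟨y, rfl⟩ := IntermediateField.mem_bot.mp ((IsGalois.mem_bot_iff_fixed x).mpr hfix)
  obtain ⟨m, rfl⟩ := IsIntegrallyClosed.isIntegral_iff.mp
    ((isIntegral_algebraMap_iff (algebraMap ℚ K).injective).mp hx)
  exact ⟨m, by simp⟩

lemma exists_prime_pow_div_factorial_lt (A c : ℝ) (N : ℕ) :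
    ∃ p : ℕ, p.Prime ∧ N < p ∧ A * c ^ p / (p - 1).factorial < 1 := by
  have h := (FloorSemiring.tendsto_pow_div_factorial_atTop c).const_mul (A * c)
  rw [mul_zero] at h
  obtain ⟨M, hM⟩ := Filter.eventually_atTop.mp (h.eventually (gt_mem_nhds one_pos))
  obtain ⟨p, hp, hpp⟩ := Nat.exists_infinite_primes (max M N + 1)
  refine ⟨p, hpp, by omega, ?_⟩
  have := hM (p - 1) (by omega)
  obtain ⟨r, rfl⟩ : ∃ r, p = r + 1 := ⟨p - 1, by omega⟩
  rw [Nat.add_sub_cancel] at this ⊢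
  rw [pow_succ]
  exact lt_of_eq_of_lt (by ring) this

theorem add_sum_exp_ne_zero {K : Type*} [Field K] [NumberField K] [IsGalois ℚ K] (φ : K →+* ℂ)
    (S : Finset K) (h0 : (0 : K) ∉ S) (w : K → ℤ) (hw0 : w 0 ≠ 0)
    (hS : ∀ σ : Gal(K/ℚ), ∀ s ∈ S, σ s ∈ S) (hw : ∀ σ : Gal(K/ℚ), ∀ s ∈ S, w (σ s) = w s) :
    (w 0 : ℂ) + ∑ s ∈ S, (w s : ℂ) * Complex.exp (φ s) ≠ 0 := by
  intro hsum
  obtain ⟨f, hf0, hf⟩ := exists_int_polynomial_aeval_eq_zero S h0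
  obtain ⟨c, hc⟩ := LindemannWeierstrass.exp_polynomial_approx f hf0
  obtain ⟨l, hl0, hl⟩ := exists_integral_multiples ℤ ℚ S
  simp_rw [zsmul_eq_mul] at hl
  set d := f.natDegree
  set W : ℝ := ∑ s ∈ S, |(w s : ℝ)|
  obtain ⟨p, hp, hpN, hpsmall⟩ := exists_prime_pow_div_factorial_lt W (|(l : ℝ)| ^ d * c)
    (max (f.eval 0).natAbs (max l.natAbs (w 0).natAbs))
  simp only [max_lt_iff] at hpN
  obtain ⟨n, hn, g, hg, happrox⟩ := hc p hpN.1 hp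
  obtain ⟨m, hm⟩ : ∃ m : ℤ, (m : K) = (l : K) ^ (p * d) * ∑ s ∈ S, (w s : K) * aeval s g := by
    refine exists_int_eq_of_fixed ?_ fun σ ↦ ?_
    · rw [Finset.mul_sum]
      refine IsIntegral.sum _ fun s hs ↦ ?_
      rw [mul_left_comm]
      exact (isIntegral_algebraMap (R := ℤ) (x := w s)).mul
        (isIntegral_pow_mul_aeval (hl s hs) (hg.trans (Nat.sub_le _ _)))
    · simp only [map_mul, map_pow, map_intCast, map_sum]
      congr 1
      have e (s : K) : σ (aeval s g) = aeval (σ s) g :=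
        (aeval_algHom_apply (σ.toAlgHom.restrictScalars ℤ) s g).symm
      refine Finset.sum_bij (fun s _ ↦ σ s) (hS σ) (fun _ _ _ _ h ↦ σ.injective h)
        (fun s hs ↦ ⟨σ.symm s, hS σ.symm s hs, by simp⟩) fun s hs ↦ ?_
      rw [hw σ s hs, e]
  have hmC : (m : ℂ) = (l : ℂ) ^ (p * d) * ∑ s ∈ S, (w s : ℂ) * aeval (φ s) g := by
    have e (s : K) : φ (aeval s g) = aeval (φ s) g :=
      (aeval_algHom_apply φ.toIntAlgHom s g).symm
    simpa [e] using congrArg φ hm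
  have hroot (s : K) (hs : s ∈ S) : φ s ∈ f.aroots ℂ := by
    have hfne : f ≠ 0 := by rintro rfl; simp at hf0
    rw [mem_aroots]
    refine ⟨hfne, ?_⟩
    have := aeval_algHom_apply φ.toIntAlgHom s f
    rw [hf s hs, map_zero] at this
    exact this
  set z : ℤ := l ^ (p * d) * n * w 0 + p * m with hz
  have hzC : (z : ℂ) = -((l : ℂ) ^ (p * d) *
      ∑ s ∈ S, (w s : ℂ) * (n • Complex.exp (φ s) - p • aeval (φ s) g)) := by
    have h1 : ∑ s ∈ S, (w s : ℂ) * (n • Complex.exp (φ s) - p • aeval (φ s) g) =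
        n * ∑ s ∈ S, (w s : ℂ) * Complex.exp (φ s) - p * ∑ s ∈ S, (w s : ℂ) * aeval (φ s) g := by
      rw [Finset.mul_sum, Finset.mul_sum, ← Finset.sum_sub_distrib]
      refine Finset.sum_congr rfl fun s _ ↦ ?_
      rw [zsmul_eq_mul, nsmul_eq_mul]
      ring
    rw [h1, hz]
    push_cast
    rw [hmC]
    linear_combination (l : ℂ) ^ (p * d) * n * hsum
  have hzlt : |(z : ℝ)| < 1 := by
    refine lt_of_le_of_lt ?_ hpsmall
    rw [← Complex.norm_intCast, hzC, norm_neg, norm_mul, norm_pow, Complex.norm_intCast]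
    calc |(l : ℝ)| ^ (p * d) * ‖∑ s ∈ S, (w s : ℂ) * (n • Complex.exp (φ s) - p • aeval (φ s) g)‖
        ≤ |(l : ℝ)| ^ (p * d) * ∑ s ∈ S, |(w s : ℝ)| * (c ^ p / (p - 1).factorial) := by
          gcongr
          refine norm_sum_le_of_le _ fun s hs ↦ ?_
          rw [norm_mul, Complex.norm_intCast]
          gcongr
          exact happrox (hroot s hs)
      _ = _ := by
          rw [← Finset.sum_mul, mul_pow, ← pow_mul, mul_comm d p]
          ring
  have hz0 : z = 0 := Int.abs_lt_one_iff.mp (by exact_mod_cast hzlt)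
  have hdvd : (p : ℤ) ∣ l ^ (p * d) * n * w 0 :=
    (dvd_add_left (dvd_mul_right _ _)).mp (hz ▸ hz0 ▸ dvd_zero _)
  have hpZ := Nat.prime_iff_prime_int.mp hp
  have hlt {a : ℤ} (ha : a ≠ 0) (hap : a.natAbs < p) : ¬ (p : ℤ) ∣ a := fun h ↦
    hap.not_ge (Nat.le_of_dvd (Int.natAbs_pos.mpr ha) (Int.natCast_dvd.mp h))
  rcases hpZ.dvd_or_dvd hdvd with h | h
  · rcases hpZ.dvd_or_dvd h with h | h
    · exact hlt hl0 hpN.2.1 (hpZ.dvd_of_dvd_pow h)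
    · exact hn h
  · exact hlt hw0 hpN.2.2 h


/-- The ring homomorphism `∑ a_s [s] ↦ ∑ a_s e^{φ(s)}` on the group ring of `(K, +)`. -/
noncomputable def expEval {K : Type*} [Field K] (φ : K →+* ℂ) : AddMonoidAlgebra ℤ K →ₐ[ℤ] ℂ :=
  AddMonoidAlgebra.lift ℤ ℂ K
    { toFun := fun s ↦ Complex.exp (φ s.toAdd)
      map_one' := by simp
      map_mul' := fun x y ↦ by simp [Complex.exp_add] }

lemma expEval_apply {K : Type*} [Field K] (φ : K →+* ℂ) (x : AddMonoidAlgebra ℤ K) :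
    expEval φ x = ∑ s ∈ x.coeff.support, (x.coeff s : ℂ) * Complex.exp (φ s) := by
  simp [expEval, AddMonoidAlgebra.lift_apply, Finsupp.sum]

lemma expEval_single {K : Type*} [Field K] (φ : K →+* ℂ) (s : K) (n : ℤ) :
    expEval φ (AddMonoidAlgebra.single s n) = n * Complex.exp (φ s) := by
  simp [expEval]

/-- The action of a Galois automorphism on the exponents of the group ring of `(K, +)`. -/
noncomputable abbrev conj {K : Type*} [Field K] [Algebra ℚ K] (σ : Gal(K/ℚ)) :
    AddMonoidAlgebra ℤ K ≃ₐ[ℤ] AddMonoidAlgebra ℤ K :=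
  AddMonoidAlgebra.domCongr ℤ ℤ (σ : K ≃+ K)

lemma coeff_map_of_conj_eq {K : Type*} [Field K] [Algebra ℚ K] {σ : Gal(K/ℚ)}
    {x : AddMonoidAlgebra ℤ K} (h : conj σ x = x) (s : K) : x.coeff (σ s) = x.coeff s := by
  conv_lhs => rw [← h, AddMonoidAlgebra.coeff_domCongr]
  congr 1
  exact σ.symm_apply_apply s

theorem expEval_ne_zero_of_conj_eq {K : Type*} [Field K] [NumberField K] [IsGalois ℚ K]
    (φ : K →+* ℂ) {x : AddMonoidAlgebra ℤ K} (h0 : x.coeff 0 ≠ 0)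
    (hx : ∀ σ : Gal(K/ℚ), conj σ x = x) : expEval φ x ≠ 0 := by
  classical
  rw [expEval_apply, ← Finset.add_sum_erase _ _ (Finsupp.mem_support_iff.mpr h0), map_zero φ,
    Complex.exp_zero, mul_one]
  refine add_sum_exp_ne_zero φ _ (Finset.notMem_erase _ _) x.coeff h0 (fun σ s hs ↦ ?_)
    fun σ s _ ↦ coeff_map_of_conj_eq (hx σ) s
  simpa [coeff_map_of_conj_eq (hx σ)] using hs

theorem expEval_ne_zero {K : Type*} [Field K] [NumberField K] [IsGalois ℚ K]
    (φ : K →+* ℂ) {x : AddMonoidAlgebra ℤ K} (hx : x ≠ 0) : expEval φ x ≠ 0 := by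
  classical
  have conj_mul (σ τ : Gal(K/ℚ)) (y : AddMonoidAlgebra ℤ K) :
      conj σ (conj τ y) = conj (σ * τ) y := by
    ext s
    simp only [AddMonoidAlgebra.coeff_domCongr]
    rfl
  set y := ∏ σ : Gal(K/ℚ), conj σ x with hy
  have hyconj (σ : Gal(K/ℚ)) : conj σ y = y := by
    rw [hy, map_prod]
    simp_rw [conj_mul]
    exact Fintype.prod_equiv (Equiv.mulLeft σ) _ _ fun _ ↦ rfl
  have hy0 : y ≠ 0 := Finset.prod_ne_zero_iff.mpr fun σ _ ↦
    (map_ne_zero_iff _ (conj σ).injective).mpr hx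
  obtain ⟨s, hs⟩ : ∃ s, y.coeff s ≠ 0 := by
    by_contra! h
    exact hy0 (AddMonoidAlgebra.ext (Finsupp.ext h))
  set z := ∑ τ : Gal(K/ℚ), AddMonoidAlgebra.single (-τ s) (1 : ℤ) with hz
  have hzconj (σ : Gal(K/ℚ)) : conj σ z = z := by
    rw [hz, map_sum]
    refine Fintype.sum_equiv (Equiv.mulLeft σ) _ _ fun τ ↦ ?_
    rw [AddMonoidAlgebra.domCongr_single, map_neg]
    rfl
  have hcoeff : (y * z).coeff 0 ≠ 0 := by
    have : (y * z).coeff 0 = Fintype.card Gal(K/ℚ) * y.coeff s := by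
      simp [hz, Finset.mul_sum, coeff_map_of_conj_eq (hyconj _)]
    rw [this]
    exact mul_ne_zero (by exact_mod_cast Fintype.card_ne_zero) hs
  have hne := expEval_ne_zero_of_conj_eq φ hcoeff fun σ ↦ by rw [map_mul, hyconj, hzconj]
  contrapose! hne
  have h1 : conj (1 : Gal(K/ℚ)) x = x := by
    ext s
    simp only [AddMonoidAlgebra.coeff_domCongr]
    rfl
  rw [map_mul, hy, map_prod, Finset.prod_eq_zero (Finset.mem_univ 1) (by rw [h1, hne]), zero_mul]

/-- The Hermite-Lindemann theorem. -/
theorem transcendental_exp {a : ℂ} (ha0 : a ≠ 0) (ha : IsAlgebraic ℚ a) :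
    Transcendental ℚ (Complex.exp a) := by
  intro hexp
  let K := IntermediateField.adjoin ℚ ((minpoly ℚ a).rootSet ℂ)
  have hsplit : IsSplittingField ℚ K (minpoly ℚ a) :=
    IntermediateField.adjoin_rootSet_isSplittingField (IsAlgClosed.splits _)
  have : FiniteDimensional ℚ K := IsSplittingField.finiteDimensional K (minpoly ℚ a)
  have : NumberField K := { }
  have : IsGalois ℚ K := .of_separable_splitting_field (minpoly.irreducible ha.isIntegral).separable
  have haK : a ∈ K := IntermediateField.subset_adjoin _ _
    ((mem_rootSet_of_ne (minpoly.ne_zero ha.isIntegral)).mpr (minpoly.aeval ℚ a))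
  obtain ⟨q, hq0, hq⟩ := (IsFractionRing.isAlgebraic_iff ℤ ℚ ℂ).mpr hexp
  let b : K := ⟨a, haK⟩
  have hb : b ≠ 0 := fun h ↦ ha0 (congrArg Subtype.val h)
  set x : AddMonoidAlgebra ℤ K :=
    ∑ i ∈ Finset.range (q.natDegree + 1), AddMonoidAlgebra.single (i * b) (q.coeff i) with hx
  have hx0 : x ≠ 0 := by
    intro h
    have h2 : x.coeff (q.natDegree * b) = q.leadingCoeff := by
      simp [hx, Finsupp.single_apply, hb]
    rw [h] at h2
    exact leadingCoeff_ne_zero.mpr hq0 h2.symm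
  refine expEval_ne_zero (algebraMap K ℂ) hx0 ?_
  rw [hx, map_sum, ← hq, aeval_eq_sum_range]
  refine Finset.sum_congr rfl fun i _ ↦ ?_
  rw [expEval_single, map_mul, map_natCast, Complex.exp_nat_mul, zsmul_eq_mul]
  rfl

end HermiteLindemann

/-- If `α ≠ 0` satisfies `(e^{α^j} + a₁)^k = g(α)` with `g(α) ≠ 0`, where `a₁` is
algebraic and `j, k` are positive integers, then `α` is transcendental. -/
theorem transcendental_of_exp_pow_eq_poly (j k : ℕ) (hj : 0 < j) (hk : 0 < k)
    (a₁ : ℂ) (ha₁ : IsAlgebraic ℚ a₁) (g : Polynomial ℚ) (α : ℂ) (hα : α ≠ 0)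
    (heq : (Complex.exp (α ^ j) + a₁) ^ k = Polynomial.aeval α g)
    (hg : Polynomial.aeval α g ≠ 0) :
    Transcendental ℚ α := by
  intro halg
  refine HermiteLindemann.transcendental_exp (pow_ne_zero j hα) (halg.pow j) ?_
  have hpow : IsAlgebraic ℚ ((Complex.exp (α ^ j) + a₁) ^ k) := by
    rw [heq]
    exact (IsIntegral.of_mem_of_fg _ halg.isIntegral.fg_adjoin_singleton _
      (Polynomial.aeval_mem_adjoin_singleton ℚ α)).isAlgebraic
  simpa using (IsAlgebraic.of_pow hk hpow).sub ha₁
end
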